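/- There is an absolute constant C > 0 such that the following holds for every positive integer n: if L₁, L₂, L₃, L₄ are four n-pencils in the complex projective plane whose four centres are pairwise distinct and do not all lie on a common line, then the set P of 4-rich points determined by these pencils satisfies |P| ≤ C · n^{11/6}. -/

import Mathlib

/-- A point of the complex projective plane: a 1-dimensional complex linear subspace of `ℂ³`. -/
def IsProjPoint (p : Submodule ℂ (Fin 3 → ℂ)) : Prop := Module.finrank ℂ p = 1

/-- A line of the complex projective plane: a 2-dimensional complex linear subspace of `ℂ³`. -/
def IsProjLine (l : Submodule ℂ (Fin 3 → ℂ)) : Prop := Module.finrank ℂ l = 2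

/-- An `n`-pencil with centre `p`: a set of `n` distinct projective lines all through `p`. -/
def IsPencil (n : ℕ) (p : Submodule ℂ (Fin 3 → ℂ))
    (L : Finset (Submodule ℂ (Fin 3 → ℂ))) : Prop :=
  IsProjPoint p ∧ L.card = n ∧ ∀ l ∈ L, IsProjLine l ∧ p ≤ l

/-- The set of 4-rich points of four pencils: points lying on one line from each pencil. -/
def RichPoints4 (L₁ L₂ L₃ L₄ : Finset (Submodule ℂ (Fin 3 → ℂ))) :
    Set (Submodule ℂ (Fin 3 → ℂ)) :=
  {q | IsProjPoint q ∧ (∃ l ∈ L₁, q ≤ l) ∧ (∃ l ∈ L₂, q ≤ l) ∧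
    (∃ l ∈ L₃, q ≤ l) ∧ (∃ l ∈ L₄, q ≤ l)}

/-- The octant of the complex plane containing `z`. -/
noncomputable def octant (z : ℂ) : Bool × Bool × Bool :=
  (decide (0 ≤ z.re), decide (0 ≤ z.im), decide (|z.im| ≤ |z.re|))

lemma sum_sq_lt_two_mul_inner {p q s t : ℝ} (ht : 0 ≤ t) (hqp : q ≤ p)
    (hq : 0 ≤ q) (hts : t ≤ s) (hpos : 0 < s) (hle : s ^ 2 + t ^ 2 ≤ p ^ 2 + q ^ 2) :
    s ^ 2 + t ^ 2 < 2 * (p * s + q * t) := by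
  rcases lt_or_ge p s with h | h
  · have hp : 0 < p := by nlinarith
    nlinarith [mul_nonneg hq ht, mul_pos hp (sub_pos.2 h), mul_nonneg (sub_nonneg.2 hqp) hq]
  · rcases eq_or_lt_of_le h with rfl | h'
    · rcases eq_or_lt_of_le hts with rfl | h''
      · nlinarith
      · nlinarith [mul_nonneg hq ht]
    · nlinarith [mul_nonneg hq ht]

/-- Two nonzero complex numbers in the same octant are closer to each other than the larger one
is to the origin. -/
lemma norm_sub_lt_of_octant_eq {x y : ℂ} (h : octant x = octant y) (hy : y ≠ 0)
    (hle : ‖y‖ ≤ ‖x‖) : ‖x - y‖ < ‖x‖ := by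
  have hsq : y.re ^ 2 + y.im ^ 2 ≤ x.re ^ 2 + x.im ^ 2 := by
    have := pow_le_pow_left₀ (norm_nonneg _) hle 2
    rw [Complex.sq_norm, Complex.sq_norm, Complex.normSq_apply, Complex.normSq_apply] at this
    linarith
  have hy0 : 0 < y.re ^ 2 + y.im ^ 2 := by
    have := Complex.normSq_pos.2 hy
    rw [Complex.normSq_apply] at this
    linarith
  simp only [octant, Prod.mk.injEq, decide_eq_decide] at h
  obtain ⟨h1, h2, h3⟩ := h
  refine lt_of_pow_lt_pow_left₀ 2 (norm_nonneg _) ?_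
  rw [Complex.sq_norm, Complex.sq_norm, Complex.normSq_apply, Complex.normSq_apply,
    Complex.sub_re, Complex.sub_im]
  have e1 : |x.re| * |y.re| = x.re * y.re := by
    rw [← abs_mul, abs_of_nonneg]
    by_cases h0 : 0 ≤ x.re
    · exact mul_nonneg h0 (h1.1 h0)
    · exact mul_nonneg_of_nonpos_of_nonpos (not_le.1 h0).le (not_le.1 (mt h1.2 h0)).le
  have e2 : |x.im| * |y.im| = x.im * y.im := by
    rw [← abs_mul, abs_of_nonneg]
    by_cases h0 : 0 ≤ x.im
    · exact mul_nonneg h0 (h2.1 h0)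
    · exact mul_nonneg_of_nonpos_of_nonpos (not_le.1 h0).le (not_le.1 (mt h2.2 h0)).le
  rw [← sq_abs y.re, ← sq_abs y.im, ← sq_abs x.re, ← sq_abs x.im] at hsq
  rw [← sq_abs y.re, ← sq_abs y.im] at hy0
  have key : |y.re| ^ 2 + |y.im| ^ 2 < 2 * (|x.re| * |y.re| + |x.im| * |y.im|) := by
    by_cases h0 : |x.im| ≤ |x.re|
    · have h0' := h3.1 h0
      refine sum_sq_lt_two_mul_inner (abs_nonneg _) h0 (abs_nonneg _) h0' ?_ hsq
      by_contra hc
      have : |y.re| = 0 := le_antisymm (not_lt.1 hc) (abs_nonneg _)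
      have : |y.im| = 0 := le_antisymm (by linarith) (abs_nonneg _)
      simp_all
    · have h0' := mt h3.2 h0
      have := sum_sq_lt_two_mul_inner (p := |x.im|) (q := |x.re|) (s := |y.im|) (t := |y.re|)
        (abs_nonneg _) (not_le.1 h0).le (abs_nonneg _) (not_le.1 h0').le
        (lt_of_le_of_lt (abs_nonneg _) (not_le.1 h0')) (by linarith)
      linarith
  rw [sq_abs, sq_abs, e1, e2] at key
  nlinarith

/-- Discs around the points of a finite planar set that reach no further than the nearest other
point cover every point of the plane at most nine times. -/
lemma card_filter_dist_le_nine {ι : Type*} [DecidableEq ι] (S : Finset ι) (f : ι → ℂ)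
    (hf : Set.InjOn f S) (d : ι → ℝ)
    (hd : ∀ i ∈ S, ∀ j ∈ S, i ≠ j → d i ≤ ‖f i - f j‖) (z : ℂ) :
    (S.filter fun i => ‖z - f i‖ ≤ d i).card ≤ 9 := by
  set T := S.filter fun i => ‖z - f i‖ ≤ d i with hT
  have h1 : (T.filter fun i => f i = z).card ≤ 1 := by
    refine Finset.card_le_one.2 fun i hi j hj => ?_
    simp only [hT, Finset.mem_filter] at hi hj
    exact hf hi.1.1 hj.1.1 (hi.2.trans hj.2.symm)
  have h2 : (T.filter fun i => ¬ f i = z).card ≤ 8 := by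
    have hinj : Set.InjOn (fun i => octant (f i - z)) (T.filter fun i => ¬ f i = z) := by
      have aux : ∀ i ∈ T.filter (fun i => ¬ f i = z), ∀ j ∈ T.filter (fun i => ¬ f i = z),
          octant (f i - z) = octant (f j - z) → ‖f j - z‖ ≤ ‖f i - z‖ → i = j := by
        intro i hi j hj h hle
        by_contra hne
        simp only [hT, Finset.mem_filter] at hi hj
        have := norm_sub_lt_of_octant_eq h (sub_ne_zero.2 hj.2) hle
        rw [sub_sub_sub_cancel_right, norm_sub_rev (f i) z] at this
        linarith [hd i hi.1.1 j hj.1.1 hne, hi.1.2]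
      intro i hi j hj h
      rcases le_total ‖f j - z‖ ‖f i - z‖ with hle | hle
      · exact aux i hi j hj h hle
      · exact (aux j hj i hi h.symm hle).symm
    have := Finset.card_le_card_of_injOn (t := Finset.univ) _ (fun _ _ => Finset.mem_univ _) hinj
    simpa using this
  have := Finset.card_filter_add_card_filter_not (s := T) (fun i => f i = z)
  omega

/-- Few points of `S` have more than `r` points of `U` in their disc. -/
lemma card_filter_crowded_le {ι : Type*} [DecidableEq ι] (S : Finset ι) (f : ι → ℂ)
    (hf : Set.InjOn f S) (d : ι → ℝ)
    (hd : ∀ i ∈ S, ∀ j ∈ S, i ≠ j → d i ≤ ‖f i - f j‖) (U : Finset ℂ) (r : ℝ) :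
    ((S.filter fun i => r < ((U.filter fun u => ‖u - f i‖ ≤ d i).card : ℝ)).card : ℝ) * r
      ≤ 9 * U.card := by
  set T := S.filter fun i => r < ((U.filter fun u => ‖u - f i‖ ≤ d i).card : ℝ) with hT
  calc (T.card : ℝ) * r = ∑ i ∈ T, r := by simp
    _ ≤ ∑ i ∈ T, ((U.filter fun u => ‖u - f i‖ ≤ d i).card : ℝ) :=
        Finset.sum_le_sum fun i hi => (Finset.mem_filter.1 hi).2.le
    _ ≤ ∑ i ∈ S, ((U.filter fun u => ‖u - f i‖ ≤ d i).card : ℝ) :=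
        Finset.sum_le_sum_of_subset_of_nonneg (Finset.filter_subset _ _)
          fun _ _ _ => Nat.cast_nonneg _
    _ = ((∑ u ∈ U, (S.filter fun i => ‖u - f i‖ ≤ d i).card : ℕ) : ℝ) := by
        rw [← Nat.cast_sum]
        congr 1
        exact Finset.sum_card_bipartiteAbove_eq_sum_card_bipartiteBelow
          (s := S) (t := U) (fun i u => ‖u - f i‖ ≤ d i)
    _ ≤ ((∑ u ∈ U, 9 : ℕ) : ℝ) := by
        exact_mod_cast Finset.sum_le_sum fun u _ => card_filter_dist_le_nine S f hf d hd u
    _ = 9 * U.card := by simp [mul_comm]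

/-- The pairs `(u, v)` of elements of `U` such that at most `r` elements of `U` are at least as
close to `u` as `v` is. -/
noncomputable def closePairs (U : Finset ℂ) (r : ℝ) : Finset (ℂ × ℂ) :=
  (U ×ˢ U).filter fun p => ((U.filter fun u => ‖u - p.1‖ ≤ ‖p.2 - p.1‖).card : ℝ) ≤ r

lemma card_closePairs_le (U : Finset ℂ) {r : ℝ} (hr : 0 ≤ r) :
    ((closePairs U r).card : ℝ) ≤ U.card * r := by
  have h : (closePairs U r).card = ∑ u ∈ U, (U.filter fun v =>
      ((U.filter fun u' => ‖u' - u‖ ≤ ‖v - u‖).card : ℝ) ≤ r).card := by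
    simp only [closePairs, Finset.card_filter, Finset.sum_product]
  rw [h, Nat.cast_sum, ← nsmul_eq_mul]
  refine Finset.sum_le_card_nsmul _ _ _ fun u _ => ?_
  set V := U.filter fun v => ((U.filter fun u' => ‖u' - u‖ ≤ ‖v - u‖).card : ℝ) ≤ r with hV
  rcases V.eq_empty_or_nonempty with h0 | h0
  · simpa [h0] using hr
  · obtain ⟨v, hv, hmax⟩ := V.exists_max_image (fun v => ‖v - u‖) h0
    refine le_trans ?_ (Finset.mem_filter.1 hv).2
    exact_mod_cast Finset.card_le_card fun w hw =>
      Finset.mem_filter.2 ⟨(Finset.mem_filter.1 hw).1, hmax w hw⟩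

/-- The points `(u, w)` of the grid `U × W` on the line `u * b₁ - w * b₂ = α`. -/
noncomputable def gridLine (U W : Finset ℂ) (α : ℂ) (b : ℂ × ℂ) : Finset (ℂ × ℂ) :=
  (U ×ˢ W).filter fun p => p.1 * b.1 - p.2 * b.2 = α

/-- The pairs of distinct points of a grid line that are close to each other in both
coordinates. -/
noncomputable def closeGridPairs (U W : Finset ℂ) (α : ℂ) (r : ℝ) (b : ℂ × ℂ) :
    Finset ((ℂ × ℂ) × (ℂ × ℂ)) :=
  (gridLine U W α b ×ˢ gridLine U W α b).filter fun p =>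
    p.1 ≠ p.2 ∧ (p.1.1, p.2.1) ∈ closePairs U r ∧ (p.1.2, p.2.2) ∈ closePairs W r

lemma card_gridLine_le {U W : Finset ℂ} {α : ℂ} {b : ℂ × ℂ} (h₁ : b.1 ≠ 0) (h₂ : b.2 ≠ 0)
    {m k r : ℝ} (hU : (U.card : ℝ) ≤ m) (hW : (W.card : ℝ) ≤ m) (hk : 1 ≤ k) (hr : 0 < r)
    (hkr : 36 * m ≤ k * r) (hcard : k < (gridLine U W α b).card) :
    ((gridLine U W α b).card : ℝ) ≤ 2 * (closeGridPairs U W α r b).card := by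
  classical
  set S := gridLine U W α b with hS
  have hmem : ∀ p ∈ S, (p.1 ∈ U ∧ p.2 ∈ W) ∧ p.1 * b.1 - p.2 * b.2 = α := fun p hp => by
    simpa [hS, gridLine] using hp
  have hnorm : ∀ p ∈ S, ∀ q ∈ S, ‖p.1 - q.1‖ * ‖b.1‖ = ‖p.2 - q.2‖ * ‖b.2‖ := by
    intro p hp q hq
    rw [← norm_mul, ← norm_mul]
    congr 1
    linear_combination (hmem p hp).2 - (hmem q hq).2
  have hb₁ : 0 < ‖b.1‖ := norm_pos_iff.2 h₁
  have hb₂ : 0 < ‖b.2‖ := norm_pos_iff.2 h₂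
  have hinj₁ : Set.InjOn (Prod.fst : ℂ × ℂ → ℂ) S := by
    intro p hp q hq h
    refine Prod.ext h ?_
    have := hnorm p hp q hq
    rw [h, sub_self, norm_zero, zero_mul, eq_comm, mul_eq_zero] at this
    exact sub_eq_zero.1 (norm_eq_zero.1 (this.resolve_right hb₂.ne'))
  have hinj₂ : Set.InjOn (Prod.snd : ℂ × ℂ → ℂ) S := by
    intro p hp q hq h
    refine Prod.ext ?_ h
    have := hnorm p hp q hq
    rw [h, sub_self, norm_zero, zero_mul, mul_eq_zero] at this
    exact sub_eq_zero.1 (norm_eq_zero.1 (this.resolve_right hb₁.ne'))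
  have hnn : ∀ p, ∃ q, p ∈ S → q ∈ S ∧ p ≠ q ∧ ∀ q' ∈ S, p ≠ q' → ‖p.1 - q.1‖ ≤ ‖p.1 - q'.1‖ := by
    intro p
    by_cases hp : p ∈ S
    · have h2 : (S.erase p).Nonempty := by
        rw [← Finset.card_pos, Finset.card_erase_of_mem hp]
        have : 1 < S.card := by exact_mod_cast hk.trans_lt hcard
        omega
      obtain ⟨q, hq, hmin⟩ := (S.erase p).exists_min_image (fun q => ‖p.1 - q.1‖) h2
      rw [Finset.mem_erase] at hq
      exact ⟨q, fun _ => ⟨hq.2, hq.1.symm, fun q' hq' hne =>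
        hmin q' (Finset.mem_erase.2 ⟨hne.symm, hq'⟩)⟩⟩
    · exact ⟨p, fun h => absurd h hp⟩
  choose nn hnn using hnn
  have hd₁ : ∀ p ∈ S, ∀ q ∈ S, p ≠ q → ‖(nn p).1 - p.1‖ ≤ ‖p.1 - q.1‖ := fun p hp q hq h => by
    rw [norm_sub_rev]
    exact (hnn p hp).2.2 q hq h
  have hd₂ : ∀ p ∈ S, ∀ q ∈ S, p ≠ q → ‖(nn p).2 - p.2‖ ≤ ‖p.2 - q.2‖ := fun p hp q hq h => by
    refine le_of_mul_le_mul_right ?_ hb₂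
    rw [← hnorm _ (hnn p hp).1 _ hp, ← hnorm _ hp _ hq]
    exact mul_le_mul_of_nonneg_right (hd₁ p hp q hq h) hb₁.le
  have c₁ := card_filter_crowded_le S Prod.fst hinj₁ (fun p => ‖(nn p).1 - p.1‖) hd₁ U r
  have c₂ := card_filter_crowded_le S Prod.snd hinj₂ (fun p => ‖(nn p).2 - p.2‖) hd₂ W r
  set T₁ := S.filter fun p => r < ((U.filter fun u => ‖u - p.1‖ ≤ ‖(nn p).1 - p.1‖).card : ℝ)
  set T₂ := S.filter fun p => r < ((W.filter fun u => ‖u - p.2‖ ≤ ‖(nn p).2 - p.2‖).card : ℝ)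
  have hgood : (S \ (T₁ ∪ T₂)).card ≤ (closeGridPairs U W α r b).card := by
    refine Finset.card_le_card_of_injOn (fun p => (p, nn p)) ?_ fun p _ q _ h => (Prod.mk.inj h).1
    intro p hp
    simp only [T₁, T₂, Finset.coe_sdiff, Finset.coe_union, Set.mem_sdiff, Set.mem_union,
      Finset.mem_coe, Finset.mem_filter, not_or, not_and, not_lt] at hp
    obtain ⟨hpS, hp₁, hp₂⟩ := hp
    obtain ⟨hq, hne, -⟩ := hnn p hpS
    simp only [closeGridPairs, closePairs, Finset.mem_coe, Finset.mem_filter, Finset.mem_product]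
    exact ⟨⟨hpS, hq⟩, hne, ⟨⟨(hmem p hpS).1.1, (hmem _ hq).1.1⟩, hp₁ hpS⟩,
      ⟨(hmem p hpS).1.2, (hmem _ hq).1.2⟩, hp₂ hpS⟩
  have hsub : S.card ≤ (S \ (T₁ ∪ T₂)).card + (T₁.card + T₂.card) :=
    (Finset.card_le_card_sdiff_add_card (s := S) (t := T₁ ∪ T₂)).trans
      (Nat.add_le_add_left (Finset.card_union_le _ _) _)
  have hsub' : (S.card : ℝ) ≤ (closeGridPairs U W α r b).card + ((T₁.card : ℝ) + T₂.card) := by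
    exact_mod_cast hsub.trans (Nat.add_le_add_right hgood _)
  have hT : ((T₁.card : ℝ) + T₂.card) ≤ k / 2 := by
    refine le_of_mul_le_mul_right ?_ hr
    linarith
  linarith

/-- A Szemerédi–Trotter bound for lines `u * b₁ - w * b₂ = α` and a Cartesian product of points
in the complex plane. -/
lemma sum_card_gridLine_le {U W B₁ B₂ : Finset ℂ} {α : ℂ} (hα : α ≠ 0) (h₁ : (0 : ℂ) ∉ B₁)
    (h₂ : (0 : ℂ) ∉ B₂) {t : ℝ} (ht : 1 ≤ t) (hU : (U.card : ℝ) ≤ t ^ 3)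
    (hW : (W.card : ℝ) ≤ t ^ 3) (hB₁ : (B₁.card : ℝ) ≤ t ^ 3) (hB₂ : (B₂.card : ℝ) ≤ t ^ 3) :
    ((∑ b ∈ B₁ ×ˢ B₂, (gridLine U W α b).card : ℕ) : ℝ) ≤ 2593 * t ^ 8 := by
  classical
  have ht0 : 0 < t := by linarith
  have hterm : ∀ b ∈ B₁ ×ˢ B₂, ((gridLine U W α b).card : ℝ) ≤
      t ^ 2 + 2 * (closeGridPairs U W α (36 * t) b).card := by
    intro b hb
    rw [Finset.mem_product] at hb
    rcases le_or_gt ((gridLine U W α b).card : ℝ) (t ^ 2) with h | h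
    · exact h.trans (le_add_of_nonneg_right (by positivity))
    · have := card_gridLine_le (fun h => h₁ (h ▸ hb.1)) (fun h => h₂ (h ▸ hb.2)) hU hW
        (one_le_pow₀ ht) (r := 36 * t) (by positivity) (by ring_nf; rfl) h
      exact this.trans (le_add_of_nonneg_left (by positivity))
  have hdisj : ∑ b ∈ B₁ ×ˢ B₂, (closeGridPairs U W α (36 * t) b).card ≤
      (closePairs U (36 * t) ×ˢ closePairs W (36 * t)).card := by
    rw [← Finset.card_biUnion]
    · refine Finset.card_le_card_of_injOn (fun p => ((p.1.1, p.2.1), (p.1.2, p.2.2))) ?_ ?_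
      · intro p hp
        simp only [Finset.mem_coe, Finset.mem_biUnion, closeGridPairs, Finset.mem_filter] at hp
        obtain ⟨b, -, -, -, h⟩ := hp
        exact Finset.mem_coe.2 (Finset.mem_product.2 h)
      · rintro ⟨⟨_, _⟩, _, _⟩ - ⟨⟨_, _⟩, _, _⟩ - h
        simp only [Prod.mk.injEq] at h ⊢
        tauto
    · intro b _ b' _ hne
      refine Finset.disjoint_left.2 fun p hp hp' => hne ?_
      obtain ⟨⟨u, w⟩, ⟨u', w'⟩⟩ := p
      simp only [closeGridPairs, gridLine, Finset.mem_filter, Finset.mem_product] at hp hp'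
      obtain ⟨⟨⟨-, e₁⟩, -, e₂⟩, hpq, -⟩ := hp
      obtain ⟨⟨⟨-, e₃⟩, -, e₄⟩, -, -⟩ := hp'
      have hdet : u * w' - u' * w ≠ 0 := by
        intro h0
        refine hpq (Prod.ext ?_ ?_)
        · refine mul_left_cancel₀ hα ?_
          show α * u = α * u'
          linear_combination (-u) * e₂ + u' * e₁ - b.2 * h0
        · refine mul_left_cancel₀ hα ?_
          show α * w = α * w'
          linear_combination (-w) * e₂ + w' * e₁ - b.1 * h0
      refine Prod.ext ?_ ?_
      · refine mul_left_cancel₀ hdet ?_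
        linear_combination w' * (e₁ - e₃) - w * (e₂ - e₄)
      · refine mul_left_cancel₀ hdet ?_
        linear_combination u' * (e₁ - e₃) - u * (e₂ - e₄)
  have hclose : ((∑ b ∈ B₁ ×ˢ B₂, (closeGridPairs U W α (36 * t) b).card : ℕ) : ℝ) ≤
      (t ^ 3 * (36 * t)) * (t ^ 3 * (36 * t)) := by
    refine (Nat.cast_le.2 hdisj).trans ?_
    rw [Finset.card_product, Nat.cast_mul]
    have hr : 0 ≤ 36 * t := by positivity
    refine mul_le_mul ((card_closePairs_le U hr).trans ?_) ((card_closePairs_le W hr).trans ?_)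
      (Nat.cast_nonneg _) (by positivity)
    · exact mul_le_mul_of_nonneg_right hU hr
    · exact mul_le_mul_of_nonneg_right hW hr
  have hlines : ((B₁ ×ˢ B₂).card : ℝ) ≤ t ^ 3 * t ^ 3 := by
    rw [Finset.card_product, Nat.cast_mul]
    exact mul_le_mul hB₁ hB₂ (Nat.cast_nonneg _) (by positivity)
  rw [Nat.cast_sum] at hclose ⊢
  calc _ ≤ ∑ b ∈ B₁ ×ˢ B₂, (t ^ 2 + 2 * ((closeGridPairs U W α (36 * t) b).card : ℝ)) :=
        Finset.sum_le_sum hterm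
    _ = (B₁ ×ˢ B₂).card * t ^ 2 +
        2 * ∑ b ∈ B₁ ×ˢ B₂, ((closeGridPairs U W α (36 * t) b).card : ℝ) := by
        rw [Finset.sum_add_distrib, Finset.mul_sum, Finset.sum_const, nsmul_eq_mul]
    _ ≤ t ^ 3 * t ^ 3 * t ^ 2 + 2 * ((t ^ 3 * (36 * t)) * (t ^ 3 * (36 * t))) := by gcongr
    _ = 2593 * t ^ 8 := by ring

/-- The affine form of the bound: two pencils are parallel to the axes, the third is centred at
the origin, and the fourth at `(α, β)`. -/
lemma card_sq_le_of_affine_pencils {A B U W : Finset ℂ} {α β : ℂ} (hα : α ≠ 0) {t : ℝ}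
    (ht : 1 ≤ t) (hA : (A.card : ℝ) ≤ t ^ 3) (hB : (B.card : ℝ) ≤ t ^ 3)
    (hU : (U.card : ℝ) ≤ t ^ 3) (hW : (W.card : ℝ) ≤ t ^ 3) (P : Finset (ℂ × ℂ))
    (hP : ∀ p ∈ P, p.1 ∈ A ∧ p.2 ∈ B ∧ p.2 ≠ 0 ∧ p.2 ≠ β ∧ p.1 / p.2 ∈ U ∧
      (p.1 - α) / (p.2 - β) ∈ W) :
    (P.card : ℝ) ^ 2 ≤ 2593 * t ^ 11 := by
  classical
  have ht0 : 0 < t := by linarith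
  set T := (P ×ˢ P).filter fun p => p.1.1 = p.2.1 with hT
  have hcs : P.card ^ 2 ≤ A.card * T.card := by
    have hsum : P.card = ∑ a ∈ A, (P.filter fun p => p.1 = a).card :=
      Finset.card_eq_sum_card_fiberwise fun p hp => (hP p hp).1
    have hTsum : T.card = ∑ a ∈ A, (P.filter fun p => p.1 = a).card ^ 2 := by
      rw [Finset.card_eq_sum_card_fiberwise (f := fun p => p.1.1) (t := A)
        fun p hp => (hP p.1 (Finset.mem_product.1 (Finset.mem_filter.1 hp).1).1).1]
      refine Finset.sum_congr rfl fun a _ => ?_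
      rw [sq, ← Finset.card_product]
      congr 1
      ext ⟨p, q⟩
      simp only [Finset.mem_filter, Finset.mem_product]
      constructor
      · rintro ⟨⟨⟨hp, hq⟩, h⟩, rfl⟩
        exact ⟨⟨hp, rfl⟩, hq, h.symm⟩
      · rintro ⟨⟨hp, rfl⟩, hq, h⟩
        exact ⟨⟨⟨hp, hq⟩, h.symm⟩, rfl⟩
    rw [hsum, hTsum]
    exact sq_sum_le_card_mul_sum_sq
  set B₁ := B.erase 0
  set B₂ := (B.image fun b => b - β).erase 0
  have hB₁ : (B₁.card : ℝ) ≤ t ^ 3 := (Nat.cast_le.2 Finset.card_erase_le).trans hB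
  have hB₂ : (B₂.card : ℝ) ≤ t ^ 3 :=
    (Nat.cast_le.2 (Finset.card_erase_le.trans Finset.card_image_le)).trans hB
  have hinc : T.card ≤ ∑ b ∈ B₁ ×ˢ B₂, (gridLine U W α b).card := by
    rw [← Finset.card_sigma]
    refine Finset.card_le_card_of_injOn (fun p => ⟨(p.1.2, p.2.2 - β),
      (p.1.1 / p.1.2, (p.2.1 - α) / (p.2.2 - β))⟩) ?_ ?_
    · rintro ⟨⟨a, b⟩, ⟨a', b'⟩⟩ hp
      simp only [hT, Finset.mem_coe, Finset.mem_filter, Finset.mem_product] at hp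
      obtain ⟨⟨hp, hq⟩, rfl⟩ := hp
      obtain ⟨-, hb, hb0, -, hu, -⟩ := hP _ hp
      obtain ⟨-, hb', -, hbβ, -, hw⟩ := hP _ hq
      simp only at hb hb0 hu hb' hbβ hw
      have hbβ' : b' - β ≠ 0 := sub_ne_zero.2 hbβ
      simp only [Finset.mem_coe, Finset.mem_sigma, Finset.mem_product, gridLine,
        Finset.mem_filter, B₁, B₂, Finset.mem_erase, Finset.mem_image]
      refine ⟨⟨⟨hb0, hb⟩, hbβ', b', hb', rfl⟩, ⟨hu, hw⟩, ?_⟩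
      rw [div_mul_cancel₀ _ hb0, div_mul_cancel₀ _ hbβ']
      ring
    · rintro ⟨⟨a, b⟩, ⟨a', b'⟩⟩ hp ⟨⟨c, d⟩, ⟨c', d'⟩⟩ hq h
      simp only [hT, Finset.mem_coe, Finset.mem_filter, Finset.mem_product] at hp hq
      obtain ⟨⟨hp, -⟩, rfl⟩ := hp
      obtain ⟨⟨hq, -⟩, rfl⟩ := hq
      have hb0 : b ≠ 0 := (hP _ hp).2.2.1
      simp only [Sigma.mk.injEq, heq_eq_eq, Prod.mk.injEq, sub_left_inj] at h
      obtain ⟨⟨rfl, rfl⟩, hac, -⟩ := h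
      rw [div_left_inj' hb0] at hac
      rw [hac]
  have hinc' : (T.card : ℝ) ≤ 2593 * t ^ 8 := (Nat.cast_le.2 hinc).trans
    (sum_card_gridLine_le hα (Finset.notMem_erase _ _) (Finset.notMem_erase _ _) ht hU hW hB₁ hB₂)
  calc (P.card : ℝ) ^ 2 ≤ A.card * T.card := by exact_mod_cast hcs
    _ ≤ t ^ 3 * (2593 * t ^ 8) := mul_le_mul hA hinc' (Nat.cast_nonneg _) (by positivity)
    _ = 2593 * t ^ 11 := by ring

lemma IsProjPoint.exists_eq_span {q : Submodule ℂ (Fin 3 → ℂ)} (hq : IsProjPoint q) :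
    ∃ v, v ≠ 0 ∧ q = ℂ ∙ v := by
  obtain ⟨v, hv, hspan⟩ := finrank_eq_one_iff'.1 hq
  refine ⟨v, by simpa using hv, le_antisymm (fun w hw => ?_) ?_⟩
  · obtain ⟨c, hc⟩ := hspan ⟨w, hw⟩
    exact Submodule.mem_span_singleton.2 ⟨c, congrArg Subtype.val hc⟩
  · simp

lemma IsProjLine.exists_relation {l : Submodule ℂ (Fin 3 → ℂ)} (hl : IsProjLine l)
    {v w w' : Fin 3 → ℂ} (hv : v ∈ l) (hw : w ∈ l) (hw' : w' ∈ l) :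
    ∃ a b c : ℂ, a • v + b • w + c • w' = 0 ∧ (a ≠ 0 ∨ b ≠ 0 ∨ c ≠ 0) := by
  have h : ¬ LinearIndependent ℂ ![(⟨v, hv⟩ : l), ⟨w, hw⟩, ⟨w', hw'⟩] := fun h => by
    have := h.fintype_card_le_finrank
    rw [Fintype.card_fin, hl] at this
    omega
  rw [Fintype.not_linearIndependent_iff] at h
  obtain ⟨g, hg, i, hi⟩ := h
  refine ⟨g 0, g 1, g 2, ?_, ?_⟩
  · have := congrArg Subtype.val hg
    simpa [Fin.sum_univ_three] using this
  · fin_cases i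
    · exact Or.inl hi
    · exact Or.inr (Or.inl hi)
    · exact Or.inr (Or.inr hi)

/-- Two linear forms vanishing at the same point of a line are proportional on that line. -/
lemma IsProjLine.mul_eq_mul {l : Submodule ℂ (Fin 3 → ℂ)} (hl : IsProjLine l)
    {v w w' : Fin 3 → ℂ} (hv : v ∈ l) (hw : w ∈ l) (hw' : w' ∈ l) (hv0 : v ≠ 0)
    {f g : (Fin 3 → ℂ) →ₗ[ℂ] ℂ} (hf : f v = 0) (hg : g v = 0) : f w * g w' = f w' * g w := by
  obtain ⟨a, b, c, h, hne⟩ := hl.exists_relation hv hw hw'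
  have e₁ : b * f w + c * f w' = 0 := by simpa [hf] using congrArg f h
  have e₂ : b * g w + c * g w' = 0 := by simpa [hg] using congrArg g h
  by_cases hb : b = 0
  · by_cases hc : c = 0
    · subst hb hc
      simp_all
    · refine mul_left_cancel₀ hc ?_
      linear_combination f w * e₂ - g w * e₁
  · refine mul_left_cancel₀ hb ?_
    linear_combination g w' * e₁ - f w' * e₂

lemma IsProjLine.eq_of_le_ker {l q q' : Submodule ℂ (Fin 3 → ℂ)} (hl : IsProjLine l)
    (hq : IsProjPoint q) (hq' : IsProjPoint q') {v : Fin 3 → ℂ} (hv : v ∈ l)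
    {f : (Fin 3 → ℂ) →ₗ[ℂ] ℂ} (hfv : f v ≠ 0) (hql : q ≤ l) (hql' : q' ≤ l)
    (hqf : q ≤ LinearMap.ker f) (hqf' : q' ≤ LinearMap.ker f) : q = q' := by
  obtain ⟨w, hw0, rfl⟩ := hq.exists_eq_span
  obtain ⟨w', hw0', rfl⟩ := hq'.exists_eq_span
  rw [Submodule.span_singleton_le_iff_mem] at hql hql' hqf hqf'
  rw [LinearMap.mem_ker] at hqf hqf'
  obtain ⟨a, b, c, h, hne⟩ := hl.exists_relation hv hql hql'
  have ha : a = 0 := by simpa [hqf, hqf', hfv] using congrArg f h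
  subst ha
  rw [zero_smul, zero_add] at h
  have hb : b ≠ 0 := by
    rintro rfl
    simp_all
  have hw : w = (-c / b) • w' := by
    have h2 : b • w = (-c) • w' := by rw [neg_smul, eq_neg_iff_add_eq_zero, h]
    rw [div_eq_inv_mul, mul_smul, ← h2, inv_smul_smul₀ hb]
  have hc : -c / b ≠ 0 := by
    intro h0
    rw [h0, zero_smul] at hw
    exact hw0 hw
  rw [hw, Submodule.span_singleton_smul_eq (IsUnit.mk0 _ hc)]

/-- If the values of `φ` on `R` are determined by a line of `L`, then `φ` takes at most `#L`
values on `R`. -/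
lemma exists_finset_card_le {γ X : Type*} [PartialOrder X] (R : Set X) (L : Finset X)
    (φ : X → γ) (hR : ∀ q ∈ R, ∃ l ∈ L, q ≤ l)
    (hφ : ∀ l ∈ L, ∀ q ∈ R, ∀ q' ∈ R, q ≤ l → q' ≤ l → φ q = φ q') :
    ∃ B : Finset γ, B.card ≤ L.card ∧ ∀ q ∈ R, φ q ∈ B := by
  classical
  choose! f hf using hR
  rcases R.eq_empty_or_nonempty with rfl | ⟨q₀, -⟩
  · exact ⟨∅, by simp, by simp⟩
  have h : ∀ l, ∃ c, l ∈ L → ∀ q ∈ R, q ≤ l → φ q = c := by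
    intro l
    by_cases h : ∃ q ∈ R, q ≤ l
    · obtain ⟨q, hq, hql⟩ := h
      exact ⟨φ q, fun hl q' hq' hql' => hφ l hl q' hq' q hq hql' hql⟩
    · exact ⟨φ q₀, fun _ q hq hql => absurd ⟨q, hq, hql⟩ h⟩
  choose ψ hψ using h
  refine ⟨L.image ψ, Finset.card_image_le, fun q hq => ?_⟩
  rw [hψ (f q) (hf q hq).1 q hq (hf q hq).2]
  exact Finset.mem_image_of_mem _ (hf q hq).1

lemma finite_and_ncard_le_of_le_ker {n : ℕ} {p : Submodule ℂ (Fin 3 → ℂ)}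
    {L : Finset (Submodule ℂ (Fin 3 → ℂ))} (hL : IsPencil n p L) {v : Fin 3 → ℂ} (hv : v ∈ p)
    {f : (Fin 3 → ℂ) →ₗ[ℂ] ℂ} (hfv : f v ≠ 0) {R : Set (Submodule ℂ (Fin 3 → ℂ))}
    (hR : ∀ q ∈ R, IsProjPoint q ∧ ∃ l ∈ L, q ≤ l) :
    (R ∩ {q | q ≤ LinearMap.ker f}).Finite ∧ (R ∩ {q | q ≤ LinearMap.ker f}).ncard ≤ n := by
  obtain ⟨B, hB, hmem⟩ := exists_finset_card_le (R ∩ {q | q ≤ LinearMap.ker f}) L id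
    (fun q hq => (hR q hq.1).2) fun l hl q hq q' hq' hql hql' =>
      (hL.2.2 l hl).1.eq_of_le_ker (hR q hq.1).1 (hR q' hq'.1).1 ((hL.2.2 l hl).2 hv) hfv
        hql hql' hq.2 hq'.2
  have hsub : R ∩ {q | q ≤ LinearMap.ker f} ⊆ (B : Set _) := hmem
  refine ⟨B.finite_toSet.subset hsub, (Set.ncard_le_ncard hsub B.finite_toSet).trans ?_⟩
  rw [Set.ncard_coe_finset, ← hL.2.1]
  exact hB

/-- The points of a pencil off the line `g = 0` through its centre, in terms of the slope
coordinate `f / g`. -/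
lemma exists_slopes {n : ℕ} {p : Submodule ℂ (Fin 3 → ℂ)}
    {L : Finset (Submodule ℂ (Fin 3 → ℂ))} (hL : IsPencil n p L) {v : Fin 3 → ℂ} (hv : v ∈ p)
    (hv0 : v ≠ 0) {f g : (Fin 3 → ℂ) →ₗ[ℂ] ℂ} (hf : f v = 0) (hg : g v = 0)
    (R : Set (Submodule ℂ (Fin 3 → ℂ))) (rep : Submodule ℂ (Fin 3 → ℂ) → Fin 3 → ℂ)
    (hrep : ∀ q ∈ R, rep q ∈ q) (hR : ∀ q ∈ R, ∃ l ∈ L, q ≤ l) (hgR : ∀ q ∈ R, g (rep q) ≠ 0) :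
    ∃ B : Finset ℂ, B.card ≤ n ∧ ∀ q ∈ R, f (rep q) / g (rep q) ∈ B := by
  rw [← hL.2.1]
  refine exists_finset_card_le R L (fun q => f (rep q) / g (rep q)) hR ?_
  intro l hl q hq q' hq' hql hql'
  rw [div_eq_div_iff (hgR q hq) (hgR q' hq')]
  exact (hL.2.2 l hl).1.mul_eq_mul ((hL.2.2 l hl).2 hv) (hql (hrep q hq)) (hql' (hrep q' hq'))
    hv0 hf hg

lemma RichPoints4_bound_of_sup_eq_top {n : ℕ} (hn : 0 < n)
    {p₁ p₂ p₃ p₄ : Submodule ℂ (Fin 3 → ℂ)} {L₁ L₂ L₃ L₄ : Finset (Submodule ℂ (Fin 3 → ℂ))}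
    (h₁ : IsPencil n p₁ L₁) (h₂ : IsPencil n p₂ L₂) (h₃ : IsPencil n p₃ L₃)
    (h₄ : IsPencil n p₄ L₄) (h₁₂₃ : p₁ ⊔ p₂ ⊔ p₃ = ⊤) (h₁₂₄ : p₁ ⊔ p₂ ⊔ p₄ = ⊤)
    (h₂₃₄ : p₂ ⊔ p₃ ⊔ p₄ = ⊤) :
    (RichPoints4 L₁ L₂ L₃ L₄).Finite ∧
      ((RichPoints4 L₁ L₂ L₃ L₄).ncard : ℝ) ≤ 54 * (n : ℝ) ^ ((11 : ℝ) / 6) := by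
  classical
  obtain ⟨v₁, hv₁, e₁⟩ := h₁.1.exists_eq_span
  obtain ⟨v₂, hv₂, e₂⟩ := h₂.1.exists_eq_span
  obtain ⟨v₃, hv₃, e₃⟩ := h₃.1.exists_eq_span
  obtain ⟨v₄, hv₄, e₄⟩ := h₄.1.exists_eq_span
  have m₁ : v₁ ∈ p₁ := e₁ ▸ Submodule.mem_span_singleton_self v₁
  have m₂ : v₂ ∈ p₂ := e₂ ▸ Submodule.mem_span_singleton_self v₂
  have m₃ : v₃ ∈ p₃ := e₃ ▸ Submodule.mem_span_singleton_self v₃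
  have m₄ : v₄ ∈ p₄ := e₄ ▸ Submodule.mem_span_singleton_self v₄
  have hspan : ⊤ ≤ Submodule.span ℂ (Set.range ![v₁, v₂, v₃]) := by
    rw [← h₁₂₃, e₁, e₂, e₃]
    simp only [sup_le_iff, Submodule.span_singleton_le_iff_mem]
    exact ⟨⟨Submodule.subset_span ⟨0, rfl⟩, Submodule.subset_span ⟨1, rfl⟩⟩,
      Submodule.subset_span ⟨2, rfl⟩⟩
  set b := basisOfTopLeSpanOfCardEqFinrank ![v₁, v₂, v₃] hspan (by simp) with hb
  have b0 : b 0 = v₁ := by simp [hb]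
  have b1 : b 1 = v₂ := by simp [hb]
  have b2 : b 2 = v₃ := by simp [hb]
  set x := b.coord 0 with hx
  set y := b.coord 1 with hy
  set z := b.coord 2 with hz
  have x₁ : x v₁ = 1 := by simp [hx, ← b0]
  have x₂ : x v₂ = 0 := by simp [hx, ← b1]
  have x₃ : x v₃ = 0 := by simp [hx, ← b2]
  have y₁ : y v₁ = 0 := by simp [hy, ← b0]
  have y₂ : y v₂ = 1 := by simp [hy, ← b1]
  have y₃ : y v₃ = 0 := by simp [hy, ← b2]
  have z₁ : z v₁ = 0 := by simp [hz, ← b0]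
  have z₂ : z v₂ = 0 := by simp [hz, ← b1]
  have z₃ : z v₃ = 1 := by simp [hz, ← b2]
  have hexp : ∀ v, v = x v • v₁ + y v • v₂ + z v • v₃ := fun v => by
    have := b.sum_repr v
    rw [Fin.sum_univ_three, b0, b1, b2] at this
    exact this.symm
  have hz₄ : z v₄ ≠ 0 := by
    intro h0
    have : p₁ ⊔ p₂ ⊔ p₄ ≤ LinearMap.ker z := by
      rw [e₁, e₂, e₄]
      simp [z₁, z₂, h0]
    rw [h₁₂₄] at this
    have := this (Submodule.mem_top (x := v₃))
    simp [z₃] at this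
  have hx₄ : x v₄ ≠ 0 := by
    intro h0
    have : p₂ ⊔ p₃ ⊔ p₄ ≤ LinearMap.ker x := by
      rw [e₂, e₃, e₄]
      simp [x₂, x₃, h0]
    rw [h₂₃₄] at this
    have := this (Submodule.mem_top (x := v₁))
    simp [x₁] at this
  set α := x v₄ / z v₄ with hα
  set β := y v₄ / z v₄ with hβ
  have hα0 : α ≠ 0 := div_ne_zero hx₄ hz₄
  set R := RichPoints4 L₁ L₂ L₃ L₄ with hR
  have hrep : ∀ q, ∃ w, IsProjPoint q → w ≠ 0 ∧ q = ℂ ∙ w := fun q => by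
    by_cases hq : IsProjPoint q
    · obtain ⟨w, hw⟩ := hq.exists_eq_span
      exact ⟨w, fun _ => hw⟩
    · exact ⟨0, fun h => absurd h hq⟩
  choose rep hrep using hrep
  have hmem : ∀ q ∈ R, rep q ∈ q := fun q hq =>
    (hrep q hq.1).2.ge (Submodule.mem_span_singleton_self _)
  have hker : ∀ (f : (Fin 3 → ℂ) →ₗ[ℂ] ℂ), ∀ q ∈ R, f (rep q) = 0 → q ≤ LinearMap.ker f :=
    fun f q hq h0 => by
      rw [(hrep q hq.1).2, Submodule.span_singleton_le_iff_mem]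
      exact h0
  obtain ⟨fin_z, card_z⟩ := finite_and_ncard_le_of_le_ker h₃ m₃ (f := z) (by simp [z₃]) (R := R)
    fun q hq => ⟨hq.1, hq.2.2.2.1⟩
  obtain ⟨fin_y, card_y⟩ := finite_and_ncard_le_of_le_ker h₂ m₂ (f := y) (by simp [y₂]) (R := R)
    fun q hq => ⟨hq.1, hq.2.2.1⟩
  obtain ⟨fin_w, card_w⟩ := finite_and_ncard_le_of_le_ker h₂ m₂ (f := y - β • z)
    (by simp [y₂, z₂]) (R := R) fun q hq => ⟨hq.1, hq.2.2.1⟩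
  set R' := R ∩ {q | z (rep q) ≠ 0 ∧ y (rep q) ≠ 0 ∧ (y - β • z) (rep q) ≠ 0} with hR'
  have hcover : R ⊆ R' ∪ (R ∩ {q | q ≤ LinearMap.ker z} ∪ (R ∩ {q | q ≤ LinearMap.ker y} ∪
      R ∩ {q | q ≤ LinearMap.ker (y - β • z)})) := by
    intro q hq
    by_cases c₁ : z (rep q) = 0
    · exact Or.inr (Or.inl ⟨hq, hker _ q hq c₁⟩)
    by_cases c₂ : y (rep q) = 0
    · exact Or.inr (Or.inr (Or.inl ⟨hq, hker _ q hq c₂⟩))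
    by_cases c₃ : (y - β • z) (rep q) = 0
    · exact Or.inr (Or.inr (Or.inr ⟨hq, hker _ q hq c₃⟩))
    exact Or.inl ⟨hq, c₁, c₂, c₃⟩
  obtain ⟨A, cardA, hA⟩ := exists_slopes h₂ m₂ hv₂ x₂ z₂ R' rep (fun q hq => hmem q hq.1)
    (fun q hq => hq.1.2.2.1) fun q hq => hq.2.1
  obtain ⟨B, cardB, hB⟩ := exists_slopes h₁ m₁ hv₁ y₁ z₁ R' rep (fun q hq => hmem q hq.1)
    (fun q hq => hq.1.2.1) fun q hq => hq.2.1
  obtain ⟨U, cardU, hU⟩ := exists_slopes h₃ m₃ hv₃ x₃ y₃ R' rep (fun q hq => hmem q hq.1)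
    (fun q hq => hq.1.2.2.2.1) fun q hq => hq.2.2.1
  obtain ⟨W, cardW, hW⟩ := exists_slopes h₄ m₄ hv₄ (f := x - α • z) (g := y - β • z)
    (by simp [hα, hz₄]) (by simp [hβ, hz₄]) R' rep (fun q hq => hmem q hq.1)
    (fun q hq => hq.1.2.2.2.2) fun q hq => hq.2.2.2
  set φ : Submodule ℂ (Fin 3 → ℂ) → ℂ × ℂ :=
    fun q => (x (rep q) / z (rep q), y (rep q) / z (rep q)) with hφ
  have hφR : ∀ q ∈ R', q = ℂ ∙ ((φ q).1 • v₁ + (φ q).2 • v₂ + v₃) := by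
    intro q hq
    have hz0 : z (rep q) ≠ 0 := hq.2.1
    have hw : rep q = z (rep q) • ((φ q).1 • v₁ + (φ q).2 • v₂ + v₃) := by
      conv_lhs => rw [hexp (rep q)]
      simp only [hφ, smul_add, smul_smul, mul_div_cancel₀ _ hz0]
    calc q = ℂ ∙ rep q := (hrep q hq.1.1).2
      _ = ℂ ∙ (z (rep q) • ((φ q).1 • v₁ + (φ q).2 • v₂ + v₃)) := by rw [← hw]
      _ = _ := Submodule.span_singleton_smul_eq (IsUnit.mk0 _ hz0) _
  have hinj : Set.InjOn φ R' := fun q hq q' hq' h => by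
    rw [hφR q hq, hφR q' hq', h]
  have hmaps : Set.MapsTo φ R' (A ×ˢ B : Finset (ℂ × ℂ)) := fun q hq =>
    Finset.mem_coe.2 (Finset.mem_product.2 ⟨hA q hq, hB q hq⟩)
  have fin_R' : R'.Finite := Set.Finite.of_injOn hmaps hinj (Finset.finite_toSet _)
  have fin_all := fin_R'.union (fin_z.union (fin_y.union fin_w))
  refine ⟨fin_all.subset hcover, ?_⟩
  set t : ℝ := (n : ℝ) ^ ((1 : ℝ) / 3) with ht
  have hn1 : (1 : ℝ) ≤ n := by exact_mod_cast hn
  have ht1 : 1 ≤ t := Real.one_le_rpow hn1 (by norm_num)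
  have ht3 : t ^ 3 = n := by
    rw [ht, ← Real.rpow_natCast, ← Real.rpow_mul (Nat.cast_nonneg _)]
    norm_num
  have hsq : ((n : ℝ) ^ ((11 : ℝ) / 6)) ^ 2 = t ^ 11 := by
    rw [ht, ← Real.rpow_natCast, ← Real.rpow_natCast, ← Real.rpow_mul (Nat.cast_nonneg _),
      ← Real.rpow_mul (Nat.cast_nonneg _)]
    norm_num
  have hle : (n : ℝ) ≤ (n : ℝ) ^ ((11 : ℝ) / 6) := by
    conv_lhs => rw [← Real.rpow_one (n : ℝ)]
    exact Real.rpow_le_rpow_of_exponent_le hn1 (by norm_num)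
  have hcast : ∀ {s : Finset ℂ}, s.card ≤ n → (s.card : ℝ) ≤ t ^ 3 := fun h => by
    rw [ht3]
    exact_mod_cast h
  have hmain := card_sq_le_of_affine_pencils hα0 (β := β) ht1 (hcast cardA) (hcast cardB)
    (hcast cardU) (hcast cardW) (fin_R'.toFinset.image φ) (by
      intro p hp
      obtain ⟨q, hq, rfl⟩ := Finset.mem_image.1 hp
      rw [Set.Finite.mem_toFinset] at hq
      obtain ⟨hz0, hy0, hw0⟩ := hq.2
      simp only [LinearMap.sub_apply, LinearMap.smul_apply, smul_eq_mul] at hw0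
      refine ⟨hA q hq, hB q hq, div_ne_zero hy0 hz0, ?_, ?_, ?_⟩
      · intro h
        rw [hφ, div_eq_iff hz0] at h
        exact hw0 (sub_eq_zero.2 h)
      · rw [hφ, div_div_div_cancel_right₀ hz0]
        exact hU q hq
      · have := hW q hq
        simp only [LinearMap.sub_apply, LinearMap.smul_apply, smul_eq_mul] at this
        rwa [hφ, div_sub' hz0, div_sub' hz0, div_div_div_cancel_right₀ hz0, mul_comm _ α,
          mul_comm _ β])
  rw [Finset.card_image_of_injOn (by simpa using hinj), ← Set.ncard_eq_toFinset_card _ fin_R',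
    ← hsq] at hmain
  have hR'card : (R'.ncard : ℝ) ≤ 51 * (n : ℝ) ^ ((11 : ℝ) / 6) := by
    refine le_of_sq_le_sq ?_ (by positivity)
    rw [mul_pow]
    nlinarith [sq_nonneg ((n : ℝ) ^ ((11 : ℝ) / 6))]
  have hcard : R.ncard ≤ R'.ncard + (n + (n + n)) :=
    (Set.ncard_le_ncard hcover fin_all).trans <| (Set.ncard_union_le _ _).trans <|
      Nat.add_le_add_left ((Set.ncard_union_le _ _).trans <| Nat.add_le_add card_z <|
        (Set.ncard_union_le _ _).trans <| Nat.add_le_add card_y card_w) _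
  have hcard' : (R.ncard : ℝ) ≤ R'.ncard + (n + (n + n)) := by exact_mod_cast hcard
  linarith

lemma IsProjPoint.isProjLine_sup {p q : Submodule ℂ (Fin 3 → ℂ)} (hp : IsProjPoint p)
    (hq : IsProjPoint q) (h : p ≠ q) : IsProjLine (p ⊔ q) := by
  have hinf : p ⊓ q = ⊥ := by
    by_contra hne
    have h0 : Module.finrank ℂ (p ⊓ q : Submodule ℂ (Fin 3 → ℂ)) ≠ 0 := by
      rwa [Ne, Submodule.finrank_eq_zero]
    have h₁ : p ⊓ q = p := Submodule.eq_of_le_of_finrank_le inf_le_left (by rw [hp]; omega)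
    have h₂ : p ⊓ q = q := Submodule.eq_of_le_of_finrank_le inf_le_right (by rw [hq]; omega)
    exact h (h₁.symm.trans h₂)
  have := Submodule.finrank_sup_add_finrank_inf_eq p q
  rw [hinf, finrank_bot, hp, hq] at this
  exact this

lemma IsProjLine.le_of_sup_ne_top {l r : Submodule ℂ (Fin 3 → ℂ)} (hl : IsProjLine l)
    (h : l ⊔ r ≠ ⊤) : r ≤ l := by
  have hlt := Submodule.finrank_lt h
  rw [Module.finrank_fin_fun] at hlt
  have : l = l ⊔ r := Submodule.eq_of_le_of_finrank_le le_sup_left (by rw [hl]; omega)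
  rw [this]
  exact le_sup_right

lemma IsProjPoint.sup_eq_top_of_collinear {a b c d : Submodule ℂ (Fin 3 → ℂ)}
    (ha : IsProjPoint a) (hb : IsProjPoint b) (hab : a ≠ b)
    (hl : ¬ ∃ l, IsProjLine l ∧ a ≤ l ∧ b ≤ l ∧ c ≤ l ∧ d ≤ l) (h : a ⊔ b ⊔ c ≠ ⊤) :
    a ⊔ b ⊔ d = ⊤ := by
  by_contra hd
  have hline := ha.isProjLine_sup hb hab
  exact hl ⟨a ⊔ b, hline, le_sup_left, le_sup_right, hline.le_of_sup_ne_top h,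
    hline.le_of_sup_ne_top hd⟩

lemma RichPoints4_swap₁₂ (L₁ L₂ L₃ L₄ : Finset (Submodule ℂ (Fin 3 → ℂ))) :
    RichPoints4 L₁ L₂ L₃ L₄ = RichPoints4 L₂ L₁ L₃ L₄ := by
  ext q
  simp only [RichPoints4, Set.mem_ofPred_eq]
  tauto

lemma RichPoints4_rotate (L₁ L₂ L₃ L₄ : Finset (Submodule ℂ (Fin 3 → ℂ))) :
    RichPoints4 L₁ L₂ L₃ L₄ = RichPoints4 L₁ L₃ L₄ L₂ := by
  ext q
  simp only [RichPoints4, Set.mem_ofPred_eq]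
  tauto

theorem four_rich_points_upper_bound_complex :
    ∃ C : ℝ, 0 < C ∧ ∀ (n : ℕ), 0 < n →
      ∀ (p₁ p₂ p₃ p₄ : Submodule ℂ (Fin 3 → ℂ))
        (L₁ L₂ L₃ L₄ : Finset (Submodule ℂ (Fin 3 → ℂ))),
        IsPencil n p₁ L₁ → IsPencil n p₂ L₂ → IsPencil n p₃ L₃ → IsPencil n p₄ L₄ →
        p₁ ≠ p₂ → p₁ ≠ p₃ → p₁ ≠ p₄ → p₂ ≠ p₃ → p₂ ≠ p₄ → p₃ ≠ p₄ →
        (¬ ∃ l, IsProjLine l ∧ p₁ ≤ l ∧ p₂ ≤ l ∧ p₃ ≤ l ∧ p₄ ≤ l) →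
        (RichPoints4 L₁ L₂ L₃ L₄).Finite ∧
          ((RichPoints4 L₁ L₂ L₃ L₄).ncard : ℝ) ≤ C * (n : ℝ) ^ ((11 : ℝ) / 6) := by
  refine ⟨54, by norm_num, ?_⟩
  intro n hn p₁ p₂ p₃ p₄ L₁ L₂ L₃ L₄ h₁ h₂ h₃ h₄ n₁₂ n₁₃ n₁₄ n₂₃ n₂₄ n₃₄ hl
  by_cases t₁₂₃ : p₁ ⊔ p₂ ⊔ p₃ = ⊤
  · by_cases t₁₂₄ : p₁ ⊔ p₂ ⊔ p₄ = ⊤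
    · by_cases t₂₃₄ : p₂ ⊔ p₃ ⊔ p₄ = ⊤
      · exact RichPoints4_bound_of_sup_eq_top hn h₁ h₂ h₃ h₄ t₁₂₃ t₁₂₄ t₂₃₄
      · have t₁₃₄ : p₃ ⊔ p₄ ⊔ p₁ = ⊤ := h₃.1.sup_eq_top_of_collinear h₄.1 n₃₄ (c := p₂)
          (by grind) (by rwa [sup_comm, ← sup_assoc])
        rw [RichPoints4_swap₁₂]
        exact RichPoints4_bound_of_sup_eq_top hn h₂ h₁ h₃ h₄ (by rw [← t₁₂₃]; ac_rfl)
          (by rw [← t₁₂₄]; ac_rfl) (by rw [← t₁₃₄]; ac_rfl)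
    · have t₁₃₄ : p₁ ⊔ p₄ ⊔ p₃ = ⊤ := h₁.1.sup_eq_top_of_collinear h₄.1 n₁₄ (c := p₂)
        (by grind) (by rwa [sup_right_comm])
      have t₂₃₄ : p₂ ⊔ p₄ ⊔ p₃ = ⊤ := h₂.1.sup_eq_top_of_collinear h₄.1 n₂₄ (c := p₁)
        (by grind) (by rwa [sup_right_comm, sup_comm p₂])
      rw [RichPoints4_rotate]
      exact RichPoints4_bound_of_sup_eq_top hn h₁ h₃ h₄ h₂ (by rw [← t₁₃₄]; ac_rfl)
        (by rw [← t₁₂₃]; ac_rfl) (by rw [← t₂₃₄]; ac_rfl)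
  · have t₁₂₄ : p₁ ⊔ p₂ ⊔ p₄ = ⊤ := h₁.1.sup_eq_top_of_collinear h₂.1 n₁₂ hl t₁₂₃
    have t₁₃₄ : p₁ ⊔ p₃ ⊔ p₄ = ⊤ := h₁.1.sup_eq_top_of_collinear h₃.1 n₁₃ (c := p₂)
      (by grind) (by rwa [sup_right_comm])
    have t₂₃₄ : p₂ ⊔ p₃ ⊔ p₄ = ⊤ := h₂.1.sup_eq_top_of_collinear h₃.1 n₂₃ (c := p₁)
      (by grind) (by rwa [sup_right_comm, sup_comm p₂])
    rw [RichPoints4_rotate, RichPoints4_rotate]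
    exact RichPoints4_bound_of_sup_eq_top hn h₁ h₄ h₂ h₃ (by rw [← t₁₂₄]; ac_rfl)
      (by rw [← t₁₃₄]; ac_rfl) (by rw [← t₂₃₄]; ac_rfl)
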